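/- arXiv:2111.07081 — 2 statements merged into one kernel-verified Lean document; each statement's English description precedes it below -/
import Mathlib

section
/- Let k be a field and C, D k-coalgebras with a linear map φ : C ⊗ D → D ⊗ C that is conormal and comultiplicative. Then Δ_φ = (id_C ⊗ φ ⊗ id_D) ∘ (Δ_C ⊗ Δ_D) is a coassociative comultiplication on C ⊗ D with counit ε_C ⊗ ε_D, making C ⊗ D a k-coalgebra (the crossed product C #^φ D). -/
open TensorProduct

variable (k : Type*) [Field k] (C D : Type*)
  [AddCommGroup C] [Module k C] [Coalgebra k C]
  [AddCommGroup D] [Module k D] [Coalgebra k D]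

/-- `φ` is conormal: `(ε_D ⊗ id_C) ∘ φ = id_C ⊗ ε_D` and `(id_D ⊗ ε_C) ∘ φ = ε_C ⊗ id_D`. -/
def IsConormalCotwist (φ : C ⊗[k] D →ₗ[k] D ⊗[k] C) : Prop :=
  ((TensorProduct.lid k C).toLinearMap ∘ₗ
      LinearMap.rTensor C (Coalgebra.counit (R := k) (A := D)) ∘ₗ φ =
    (TensorProduct.rid k C).toLinearMap ∘ₗ
      LinearMap.lTensor C (Coalgebra.counit (R := k) (A := D))) ∧
  ((TensorProduct.rid k D).toLinearMap ∘ₗ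
      LinearMap.lTensor D (Coalgebra.counit (R := k) (A := C)) ∘ₗ φ =
    (TensorProduct.lid k D).toLinearMap ∘ₗ
      LinearMap.rTensor D (Coalgebra.counit (R := k) (A := C)))

/-- `φ` is comultiplicative:
`(id_D ⊗ Δ_C) ∘ φ = (φ ⊗ id_C) ∘ (id_C ⊗ φ) ∘ (Δ_C ⊗ id_D)` and
`(Δ_D ⊗ id_C) ∘ φ = (id_D ⊗ φ) ∘ (φ ⊗ id_D) ∘ (id_C ⊗ Δ_D)`. -/
def IsComultiplicativeCotwist (φ : C ⊗[k] D →ₗ[k] D ⊗[k] C) : Prop :=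
  (LinearMap.lTensor D (Coalgebra.comul (R := k) (A := C)) ∘ₗ φ =
    (TensorProduct.assoc k D C C).toLinearMap ∘ₗ LinearMap.rTensor C φ ∘ₗ
      (TensorProduct.assoc k C D C).symm.toLinearMap ∘ₗ LinearMap.lTensor C φ ∘ₗ
      (TensorProduct.assoc k C C D).toLinearMap ∘ₗ
      LinearMap.rTensor D (Coalgebra.comul (R := k) (A := C))) ∧
  (LinearMap.rTensor C (Coalgebra.comul (R := k) (A := D)) ∘ₗ φ =
    (TensorProduct.assoc k D D C).symm.toLinearMap ∘ₗ LinearMap.lTensor D φ ∘ₗ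
      (TensorProduct.assoc k D C D).toLinearMap ∘ₗ LinearMap.rTensor D φ ∘ₗ
      (TensorProduct.assoc k C D D).symm.toLinearMap ∘ₗ
      LinearMap.lTensor C (Coalgebra.comul (R := k) (A := D)))

/-- The comultiplication `Δ_φ = (id_C ⊗ φ ⊗ id_D) ∘ (Δ_C ⊗ Δ_D)` of the crossed
product coalgebra `C #^φ D`. -/
noncomputable def crossComul (φ : C ⊗[k] D →ₗ[k] D ⊗[k] C) :
    C ⊗[k] D →ₗ[k] (C ⊗[k] D) ⊗[k] (C ⊗[k] D) :=
  (TensorProduct.assoc k C D (C ⊗[k] D)).symm.toLinearMap ∘ₗ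
    LinearMap.lTensor C ((TensorProduct.assoc k D C D).toLinearMap ∘ₗ
      LinearMap.rTensor D φ ∘ₗ (TensorProduct.assoc k C D D).symm.toLinearMap) ∘ₗ
    (TensorProduct.assoc k C C (D ⊗[k] D)).toLinearMap ∘ₗ
    TensorProduct.map (Coalgebra.comul (R := k) (A := C)) (Coalgebra.comul (R := k) (A := D))

/-- The counit `ε_C ⊗ ε_D` of the crossed product coalgebra. -/
noncomputable def crossCounit : C ⊗[k] D →ₗ[k] k :=
  (TensorProduct.lid k k).toLinearMap ∘ₗ
    TensorProduct.map (Coalgebra.counit (R := k) (A := C)) (Coalgebra.counit (R := k) (A := D))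

/-- The map `id_C ⊗ φ ⊗ id_D`, with regrouping of the tensor factors. -/
noncomputable def crossMiddle (φ : C ⊗[k] D →ₗ[k] D ⊗[k] C) :
    (C ⊗[k] C) ⊗[k] (D ⊗[k] D) →ₗ[k] (C ⊗[k] D) ⊗[k] (C ⊗[k] D) :=
  (TensorProduct.assoc k C D (C ⊗[k] D)).symm.toLinearMap ∘ₗ
    LinearMap.lTensor C ((TensorProduct.assoc k D C D).toLinearMap ∘ₗ
      LinearMap.rTensor D φ ∘ₗ (TensorProduct.assoc k C D D).symm.toLinearMap) ∘ₗ
    (TensorProduct.assoc k C C (D ⊗[k] D)).toLinearMap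

section

set_option linter.unusedSectionVars false

variable {k C D}

lemma crossComul_tmul (φ : C ⊗[k] D →ₗ[k] D ⊗[k] C) (c : C) (d : D) :
    crossComul k C D φ (c ⊗ₜ d) =
      crossMiddle k C D φ (Coalgebra.comul (R := k) c ⊗ₜ Coalgebra.comul (R := k) d) := rfl

/-- For fixed `a` and `q`, the regrouping
`(d ⊗ c) ↦ (a ⊗ d) ⊗ (c ⊗ q)`. -/
noncomputable def flank (a : C) (q : D) : D ⊗[k] C →ₗ[k] (C ⊗[k] D) ⊗[k] (C ⊗[k] D) :=
  TensorProduct.map (TensorProduct.mk k C D a) ((TensorProduct.mk k C D).flip q)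

@[simp]
lemma flank_tmul (a : C) (q : D) (d : D) (c : C) :
    flank (k := k) a q (d ⊗ₜ c) = (a ⊗ₜ d) ⊗ₜ (c ⊗ₜ q) := rfl

lemma crossMiddle_tmul (φ : C ⊗[k] D →ₗ[k] D ⊗[k] C) (a b : C) (p q : D) :
    crossMiddle k C D φ ((a ⊗ₜ b) ⊗ₜ (p ⊗ₜ q)) = flank a q (φ (b ⊗ₜ p)) := by
  simp only [crossMiddle, LinearMap.comp_apply, LinearEquiv.coe_coe, TensorProduct.assoc_tmul,
    TensorProduct.assoc_symm_tmul, LinearMap.lTensor_tmul, LinearMap.rTensor_tmul]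
  induction φ (b ⊗ₜ p) using TensorProduct.induction_on with
  | zero => simp
  | tmul d c => simp
  | add x y hx hy => simp only [TensorProduct.add_tmul, TensorProduct.tmul_add, map_add, hx, hy]

/-- The regrouping of `(a ⊗ (b ⊗ c)) ⊗ (p ⊗ (q ⊗ r))` into `a ⊗ ((b ⊗ (c ⊗ p) ⊗ q) ⊗ r)`, followed
by `φ` on the innermost pair, by `φ ⊗ φ` on the resulting four middle factors, and by
`((d ⊗ c) ⊗ (d' ⊗ c')) ↦ (a ⊗ d) ⊗ ((c ⊗ d') ⊗ (c' ⊗ r))`. -/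
noncomputable def crossTriple (φ : C ⊗[k] D →ₗ[k] D ⊗[k] C) :
    (C ⊗[k] (C ⊗[k] C)) ⊗[k] (D ⊗[k] (D ⊗[k] D)) →ₗ[k]
      (C ⊗[k] D) ⊗[k] ((C ⊗[k] D) ⊗[k] (C ⊗[k] D)) :=
  (TensorProduct.assoc k C D ((C ⊗[k] D) ⊗[k] (C ⊗[k] D))).symm.toLinearMap ∘ₗ
    (((TensorProduct.assoc k D (C ⊗[k] D) (C ⊗[k] D)).toLinearMap ∘ₗ
      (TensorProduct.assoc k D C D).toLinearMap.rTensor (C ⊗[k] D) ∘ₗ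
      (TensorProduct.assoc k (D ⊗[k] C) D (C ⊗[k] D)).symm.toLinearMap ∘ₗ
      (TensorProduct.assoc k D C D).toLinearMap.lTensor (D ⊗[k] C) ∘ₗ
      (TensorProduct.assoc k (D ⊗[k] C) (D ⊗[k] C) D).toLinearMap ∘ₗ
      (TensorProduct.map φ φ ∘ₗ crossMiddle k C D φ).rTensor D ∘ₗ
      (TensorProduct.assoc k (C ⊗[k] C) (D ⊗[k] D) D).symm.toLinearMap ∘ₗ
      (TensorProduct.assoc k D D D).symm.toLinearMap.lTensor (C ⊗[k] C)).lTensor C) ∘ₗ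
    (TensorProduct.assoc k C (C ⊗[k] C) (D ⊗[k] (D ⊗[k] D))).toLinearMap

lemma crossTriple_tmul (φ : C ⊗[k] D →ₗ[k] D ⊗[k] C) (a b c : C) (p q r : D) :
    crossTriple φ ((a ⊗ₜ (b ⊗ₜ c)) ⊗ₜ (p ⊗ₜ (q ⊗ₜ r))) =
      ((TensorProduct.assoc k C D ((C ⊗[k] D) ⊗[k] (C ⊗[k] D))).symm.toLinearMap ∘ₗ
        TensorProduct.mk k C (D ⊗[k] ((C ⊗[k] D) ⊗[k] (C ⊗[k] D))) a ∘ₗ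
        (TensorProduct.assoc k D (C ⊗[k] D) (C ⊗[k] D)).toLinearMap ∘ₗ
        (TensorProduct.assoc k D C D).toLinearMap.rTensor (C ⊗[k] D) ∘ₗ
        (TensorProduct.assoc k (D ⊗[k] C) D (C ⊗[k] D)).symm.toLinearMap ∘ₗ
        (TensorProduct.assoc k D C D).toLinearMap.lTensor (D ⊗[k] C) ∘ₗ
        (TensorProduct.assoc k (D ⊗[k] C) (D ⊗[k] C) D).toLinearMap ∘ₗ
        (TensorProduct.mk k ((D ⊗[k] C) ⊗[k] (D ⊗[k] C)) D).flip r ∘ₗ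
        TensorProduct.map φ φ) (flank b q (φ (c ⊗ₜ p))) := by
  simp [crossTriple, crossMiddle_tmul]

/-- The iterated coproduct obtained by splitting the left leg, before using coassociativity. -/
lemma rTensor_crossComul_crossMiddle (φ : C ⊗[k] D →ₗ[k] D ⊗[k] C)
    (hφ : LinearMap.rTensor C (Coalgebra.comul (R := k) (A := D)) ∘ₗ φ =
      (TensorProduct.assoc k D D C).symm.toLinearMap ∘ₗ LinearMap.lTensor D φ ∘ₗ
        (TensorProduct.assoc k D C D).toLinearMap ∘ₗ LinearMap.rTensor D φ ∘ₗ
        (TensorProduct.assoc k C D D).symm.toLinearMap ∘ₗ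
        LinearMap.lTensor C (Coalgebra.comul (R := k) (A := D)))
    (x : C ⊗[k] C) (y : D ⊗[k] D) :
    TensorProduct.assoc k (C ⊗[k] D) (C ⊗[k] D) (C ⊗[k] D)
        ((crossComul k C D φ).rTensor (C ⊗[k] D) (crossMiddle k C D φ (x ⊗ₜ y))) =
      crossTriple φ
        (TensorProduct.assoc k C C C ((Coalgebra.comul (R := k)).rTensor C x) ⊗ₜ
          TensorProduct.assoc k D D D ((Coalgebra.comul (R := k)).rTensor D y)) := by
  induction x using TensorProduct.induction_on with
  | zero => simp
  | add x x' hx hx' => simp only [TensorProduct.add_tmul, map_add, hx, hx']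
  | tmul a b =>
  induction y using TensorProduct.induction_on with
  | zero => simp
  | add y y' hy hy' => simp only [TensorProduct.tmul_add, map_add, hy, hy']
  | tmul p q =>
  rw [crossMiddle_tmul, LinearMap.rTensor_tmul, LinearMap.rTensor_tmul]
  have split (t : D ⊗[k] C) : (crossComul k C D φ).rTensor (C ⊗[k] D) (flank a q t) =
      TensorProduct.map (crossMiddle k C D φ ∘ₗ TensorProduct.mk k _ _ (Coalgebra.comul (R := k) a))
        ((TensorProduct.mk k C D).flip q) ((Coalgebra.comul (R := k)).rTensor C t) := by
    induction t using TensorProduct.induction_on with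
    | zero => simp
    | tmul d c => simp [crossComul_tmul]
    | add t t' ht ht' => simp only [map_add, ht, ht']
  have hbp := LinearMap.congr_fun hφ (b ⊗ₜ p)
  simp only [LinearMap.comp_apply, LinearEquiv.coe_coe, LinearMap.lTensor_tmul] at hbp
  rw [split, hbp]
  induction Coalgebra.comul (R := k) a using TensorProduct.induction_on with
  | zero => simp
  | add s s' hs hs' =>
    simp only [map_add, LinearMap.comp_add, TensorProduct.map_add_left, LinearMap.add_apply,
      TensorProduct.add_tmul, hs, hs']
  | tmul a₁ a₂ =>
  induction Coalgebra.comul (R := k) p using TensorProduct.induction_on with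
  | zero => simp
  | add s s' hs hs' => simp only [map_add, TensorProduct.add_tmul, TensorProduct.tmul_add, hs, hs']
  | tmul p₁ p₂ =>
  simp only [TensorProduct.assoc_tmul, TensorProduct.assoc_symm_tmul, LinearMap.rTensor_tmul,
    crossTriple_tmul]
  induction φ (b ⊗ₜ p₁) using TensorProduct.induction_on with
  | zero => simp
  | add s s' hs hs' => simp only [map_add, TensorProduct.add_tmul, hs, hs']
  | tmul d c =>
  simp only [TensorProduct.assoc_tmul, LinearMap.lTensor_tmul, LinearMap.comp_apply,
    flank_tmul, TensorProduct.map_tmul]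
  induction φ (c ⊗ₜ p₂) using TensorProduct.induction_on with
  | zero => simp
  | add s s' hs hs' => simp only [map_add, TensorProduct.tmul_add, hs, hs']
  | tmul d' c' =>
  simp only [TensorProduct.assoc_symm_tmul, TensorProduct.map_tmul, LinearMap.comp_apply,
    TensorProduct.mk_apply, crossMiddle_tmul]
  induction φ (a₂ ⊗ₜ d) using TensorProduct.induction_on with
  | zero => simp
  | add s s' hs hs' => simp only [map_add, TensorProduct.add_tmul, TensorProduct.tmul_add, hs, hs']
  | tmul d'' c'' => simp

/-- The iterated coproduct obtained by splitting the right leg, before using coassociativity. -/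
lemma lTensor_crossComul_crossMiddle (φ : C ⊗[k] D →ₗ[k] D ⊗[k] C)
    (hφ : LinearMap.lTensor D (Coalgebra.comul (R := k) (A := C)) ∘ₗ φ =
      (TensorProduct.assoc k D C C).toLinearMap ∘ₗ LinearMap.rTensor C φ ∘ₗ
        (TensorProduct.assoc k C D C).symm.toLinearMap ∘ₗ LinearMap.lTensor C φ ∘ₗ
        (TensorProduct.assoc k C C D).toLinearMap ∘ₗ
        LinearMap.rTensor D (Coalgebra.comul (R := k) (A := C)))
    (x : C ⊗[k] C) (y : D ⊗[k] D) :
    (crossComul k C D φ).lTensor (C ⊗[k] D) (crossMiddle k C D φ (x ⊗ₜ y)) =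
      crossTriple φ
        ((Coalgebra.comul (R := k)).lTensor C x ⊗ₜ (Coalgebra.comul (R := k)).lTensor D y) := by
  induction x using TensorProduct.induction_on with
  | zero => simp
  | add x x' hx hx' => simp only [TensorProduct.add_tmul, map_add, hx, hx']
  | tmul a b =>
  induction y using TensorProduct.induction_on with
  | zero => simp
  | add y y' hy hy' => simp only [TensorProduct.tmul_add, map_add, hy, hy']
  | tmul p q =>
  rw [crossMiddle_tmul, LinearMap.lTensor_tmul, LinearMap.lTensor_tmul]
  have split (t : D ⊗[k] C) : (crossComul k C D φ).lTensor (C ⊗[k] D) (flank a q t) =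
      TensorProduct.map (TensorProduct.mk k C D a) (crossMiddle k C D φ ∘ₗ
        (TensorProduct.mk k _ _).flip (Coalgebra.comul (R := k) q))
        ((Coalgebra.comul (R := k)).lTensor D t) := by
    induction t using TensorProduct.induction_on with
    | zero => simp
    | tmul d c => simp [crossComul_tmul]
    | add t t' ht ht' => simp only [map_add, ht, ht']
  have hbp := LinearMap.congr_fun hφ (b ⊗ₜ p)
  simp only [LinearMap.comp_apply, LinearEquiv.coe_coe, LinearMap.rTensor_tmul] at hbp
  rw [split, hbp]
  induction Coalgebra.comul (R := k) b using TensorProduct.induction_on with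
  | zero => simp
  | add s s' hs hs' => simp only [map_add, TensorProduct.add_tmul, TensorProduct.tmul_add, hs, hs']
  | tmul b₁ b₂ =>
  induction Coalgebra.comul (R := k) q using TensorProduct.induction_on with
  | zero => simp
  | add s s' hs hs' =>
    simp only [map_add, LinearMap.comp_add, TensorProduct.map_add_right, LinearMap.add_apply,
      TensorProduct.tmul_add, hs, hs']
  | tmul q₁ q₂ =>
  simp only [TensorProduct.assoc_tmul, LinearMap.lTensor_tmul, crossTriple_tmul]
  induction φ (b₂ ⊗ₜ p) using TensorProduct.induction_on with
  | zero => simp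
  | add s s' hs hs' => simp only [map_add, TensorProduct.tmul_add, hs, hs']
  | tmul d c =>
  simp only [TensorProduct.assoc_symm_tmul, LinearMap.rTensor_tmul, LinearMap.comp_apply,
    flank_tmul, TensorProduct.map_tmul]
  induction φ (b₁ ⊗ₜ d) using TensorProduct.induction_on with
  | zero => simp
  | add s s' hs hs' => simp only [map_add, TensorProduct.add_tmul, hs, hs']
  | tmul d' c' =>
  simp only [TensorProduct.assoc_tmul, TensorProduct.map_tmul, LinearMap.comp_apply,
    LinearMap.flip_apply, TensorProduct.mk_apply, crossMiddle_tmul]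
  induction φ (c ⊗ₜ q₁) using TensorProduct.induction_on with
  | zero => simp
  | add s s' hs hs' => simp only [map_add, TensorProduct.add_tmul, TensorProduct.tmul_add, hs, hs']
  | tmul d'' c'' => simp

lemma lid_rTensor_crossCounit_crossMiddle (φ : C ⊗[k] D →ₗ[k] D ⊗[k] C)
    (hφ : (TensorProduct.lid k C).toLinearMap ∘ₗ
        LinearMap.rTensor C (Coalgebra.counit (R := k) (A := D)) ∘ₗ φ =
      (TensorProduct.rid k C).toLinearMap ∘ₗ
        LinearMap.lTensor C (Coalgebra.counit (R := k) (A := D)))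
    (x : C ⊗[k] C) (y : D ⊗[k] D) :
    TensorProduct.lid k (C ⊗[k] D)
        ((crossCounit k C D).rTensor (C ⊗[k] D) (crossMiddle k C D φ (x ⊗ₜ y))) =
      TensorProduct.lid k C ((Coalgebra.counit (R := k)).rTensor C x) ⊗ₜ
        TensorProduct.lid k D ((Coalgebra.counit (R := k)).rTensor D y) := by
  induction x using TensorProduct.induction_on with
  | zero => simp
  | add x x' hx hx' => simp only [TensorProduct.add_tmul, map_add, hx, hx']
  | tmul a b =>
  induction y using TensorProduct.induction_on with
  | zero => simp
  | add y y' hy hy' => simp only [TensorProduct.tmul_add, map_add, hy, hy']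
  | tmul p q =>
  have collapse (t : D ⊗[k] C) : TensorProduct.lid k (C ⊗[k] D)
      ((crossCounit k C D).rTensor (C ⊗[k] D) (flank a q t)) =
      Coalgebra.counit (R := k) a •
        (TensorProduct.lid k C ((Coalgebra.counit (R := k)).rTensor C t) ⊗ₜ q) := by
    induction t using TensorProduct.induction_on with
    | zero => simp
    | tmul d c => simp [crossCounit, TensorProduct.smul_tmul', mul_smul]
    | add t t' ht ht' => simp only [map_add, TensorProduct.add_tmul, smul_add, ht, ht']
  have hbp := LinearMap.congr_fun hφ (b ⊗ₜ p)
  simp only [LinearMap.comp_apply, LinearEquiv.coe_coe] at hbp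
  rw [crossMiddle_tmul, collapse, hbp]
  simp [TensorProduct.smul_tmul', smul_smul, mul_comm]

lemma rid_lTensor_crossCounit_crossMiddle (φ : C ⊗[k] D →ₗ[k] D ⊗[k] C)
    (hφ : (TensorProduct.rid k D).toLinearMap ∘ₗ
        LinearMap.lTensor D (Coalgebra.counit (R := k) (A := C)) ∘ₗ φ =
      (TensorProduct.lid k D).toLinearMap ∘ₗ
        LinearMap.rTensor D (Coalgebra.counit (R := k) (A := C)))
    (x : C ⊗[k] C) (y : D ⊗[k] D) :
    TensorProduct.rid k (C ⊗[k] D)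
        ((crossCounit k C D).lTensor (C ⊗[k] D) (crossMiddle k C D φ (x ⊗ₜ y))) =
      TensorProduct.rid k C ((Coalgebra.counit (R := k)).lTensor C x) ⊗ₜ
        TensorProduct.rid k D ((Coalgebra.counit (R := k)).lTensor D y) := by
  induction x using TensorProduct.induction_on with
  | zero => simp
  | add x x' hx hx' => simp only [TensorProduct.add_tmul, map_add, hx, hx']
  | tmul a b =>
  induction y using TensorProduct.induction_on with
  | zero => simp
  | add y y' hy hy' => simp only [TensorProduct.tmul_add, map_add, hy, hy']
  | tmul p q =>
  have collapse (t : D ⊗[k] C) : TensorProduct.rid k (C ⊗[k] D)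
      ((crossCounit k C D).lTensor (C ⊗[k] D) (flank a q t)) =
      Coalgebra.counit (R := k) q •
        (a ⊗ₜ TensorProduct.rid k D ((Coalgebra.counit (R := k)).lTensor D t)) := by
    induction t using TensorProduct.induction_on with
    | zero => simp
    | tmul d c => simp [crossCounit, smul_smul, mul_comm]
    | add t t' ht ht' => simp only [map_add, TensorProduct.tmul_add, smul_add, ht, ht']
  have hbp := LinearMap.congr_fun hφ (b ⊗ₜ p)
  simp only [LinearMap.comp_apply, LinearEquiv.coe_coe] at hbp
  rw [crossMiddle_tmul, collapse, hbp]
  simp [TensorProduct.smul_tmul', smul_smul, mul_comm]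

end

/-- If `φ` is conormal and comultiplicative, then `Δ_φ` is a coassociative
comultiplication on `C ⊗ D` with counit `ε_C ⊗ ε_D`, making `C ⊗ D` a coalgebra
(the crossed product `C #^φ D`). -/
theorem crossComul_coassoc_counital (φ : C ⊗[k] D →ₗ[k] D ⊗[k] C)
    (hco : IsConormalCotwist k C D φ) (hcm : IsComultiplicativeCotwist k C D φ) :
    ((TensorProduct.assoc k (C ⊗[k] D) (C ⊗[k] D) (C ⊗[k] D)).toLinearMap ∘ₗ
        (crossComul k C D φ).rTensor (C ⊗[k] D) ∘ₗ crossComul k C D φ =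
      (crossComul k C D φ).lTensor (C ⊗[k] D) ∘ₗ crossComul k C D φ) ∧
    ((TensorProduct.lid k (C ⊗[k] D)).toLinearMap ∘ₗ
        (crossCounit k C D).rTensor (C ⊗[k] D) ∘ₗ crossComul k C D φ = LinearMap.id) ∧
    ((TensorProduct.rid k (C ⊗[k] D)).toLinearMap ∘ₗ
        (crossCounit k C D).lTensor (C ⊗[k] D) ∘ₗ crossComul k C D φ = LinearMap.id) := by
  refine ⟨TensorProduct.ext' fun c d => ?_, TensorProduct.ext' fun c d => ?_,
    TensorProduct.ext' fun c d => ?_⟩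
  · simp only [LinearMap.comp_apply, LinearEquiv.coe_coe, crossComul_tmul]
    rw [rTensor_crossComul_crossMiddle φ hcm.2, lTensor_crossComul_crossMiddle φ hcm.1,
      Coalgebra.coassoc_apply, Coalgebra.coassoc_apply]
  · simp only [LinearMap.comp_apply, LinearEquiv.coe_coe, crossComul_tmul]
    rw [lid_rTensor_crossCounit_crossMiddle φ hco.1]
    simp
  · simp only [LinearMap.comp_apply, LinearEquiv.coe_coe, crossComul_tmul]
    rw [rid_lTensor_crossCounit_crossMiddle φ hco.2]
    simp
end

section
/- Let k be an algebraically closed field and A a complete local commutative noetherian ring with maximal ideal 𝔪 and residue field A/𝔪 ≅ k. Then every Azumaya algebra over A is isomorphic to a matrix ring M_n(A) for some n. -/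
open TensorProduct

/-- The natural map `R ⊗[A] Rᵐᵒᵖ → End_A(R)`, `r ⊗ s ↦ (x ↦ r * x * s.unop)`, whose
bijectivity defines an Azumaya algebra. -/
noncomputable def azumayaMap (A : Type*) [CommRing A] (R : Type*) [Ring R] [Algebra A R] :
    R ⊗[A] Rᵐᵒᵖ →ₗ[A] Module.End A R :=
  TensorProduct.lift <| LinearMap.mk₂ A
    (fun r s => LinearMap.mulLeftRight A (r, s.unop))
    (fun r r' s => by ext x; simp [LinearMap.mulLeftRight_apply, add_mul])
    (fun a r s => by ext x; simp [LinearMap.mulLeftRight_apply, smul_mul_assoc])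
    (fun r s s' => by ext x; simp [LinearMap.mulLeftRight_apply, mul_add])
    (fun a r s => by ext x; simp [LinearMap.mulLeftRight_apply, mul_smul_comm])

open IsLocalRing Module

section AdicallyComplete

variable {A : Type*} [CommRing A]

lemma Module.Basis.mem_smul_top_iff {M ι : Type*} [AddCommGroup M] [Module A M] [Finite ι]
    (b : Basis ι A M) (I : Ideal A) (x : M) :
    x ∈ (I • ⊤ : Submodule A M) ↔ ∀ i, b.repr x i ∈ I := by
  have := Fintype.ofFinite ι
  constructor
  · intro hx i
    induction hx using Submodule.smul_induction_on' with
    | smul r hr m _ => simpa using I.mul_mem_right _ hr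
    | add y _ z _ hy hz => simpa using I.add_mem hy hz
  · intro h
    rw [← b.sum_repr x]
    exact Submodule.sum_mem _ fun i _ => Submodule.smul_mem_smul (h i) trivial

lemma IsPrecomplete.of_basis {M ι : Type*} [AddCommGroup M] [Module A M] [Finite ι]
    (b : Basis ι A M) (I : Ideal A) [IsPrecomplete I A] : IsPrecomplete I M := by
  have := Fintype.ofFinite ι
  refine ⟨fun f hf => ?_⟩
  have hcoord (i : ι) : ∃ L : A, ∀ n, b.repr (f n) i ≡ L [SMOD (I ^ n • ⊤ : Submodule A A)] := by
    refine IsPrecomplete.prec' _ fun {m n} hmn => ?_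
    have := hf hmn
    rw [SModEq.sub_mem, b.mem_smul_top_iff] at this
    rw [SModEq.sub_mem]
    simpa using this i
  choose L hL using hcoord
  refine ⟨∑ i, L i • b i, fun n => ?_⟩
  rw [SModEq.sub_mem, b.mem_smul_top_iff]
  intro i
  have := hL i n
  rw [SModEq.sub_mem] at this
  rw [map_sub, Finsupp.sub_apply, b.repr_sum_self]
  simpa using this

variable {R : Type*} [Ring R] [Algebra A R]

lemma Ideal.mul_mem_mul_smul_top {I J : Ideal A} {x y : R}
    (hx : x ∈ (I • ⊤ : Submodule A R)) (hy : y ∈ (J • ⊤ : Submodule A R)) :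
    x * y ∈ ((I * J) • ⊤ : Submodule A R) := by
  induction hx using Submodule.smul_induction_on' with
  | smul r hr m _ =>
    induction hy using Submodule.smul_induction_on' with
    | smul s hs n _ =>
      rw [smul_mul_smul_comm]
      exact Submodule.smul_mem_smul (Ideal.mul_mem_mul hr hs) trivial
    | add y _ z _ hy hz => rw [mul_add]; exact add_mem hy hz
  | add y _ z _ hy hz => rw [add_mul]; exact add_mem hy hz

lemma Ideal.mul_mem_smul_top_left {I : Ideal A} (x : R) {y : R}
    (hy : y ∈ (I • ⊤ : Submodule A R)) : x * y ∈ (I • ⊤ : Submodule A R) := by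
  simpa using Ideal.mul_mem_mul_smul_top (I := ⊤) (x := x) (by simp) hy

lemma Ideal.mul_mem_smul_top_right {I : Ideal A} {x : R} (y : R)
    (hx : x ∈ (I • ⊤ : Submodule A R)) : x * y ∈ (I • ⊤ : Submodule A R) := by
  simpa using Ideal.mul_mem_mul_smul_top (J := ⊤) (y := y) hx (by simp)

/-- Idempotents lift along `R → R / I R` when `R` is `I`-adically complete as a module. -/
lemma exists_isIdempotentElem_sub_mem_smul_top (I : Ideal A) [IsAdicComplete I R] (a : R)
    (ha : a * a - a ∈ (I • ⊤ : Submodule A R)) :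
    ∃ e : R, IsIdempotentElem e ∧ e - a ∈ (I • ⊤ : Submodule A R) := by
  let next : R → R := fun x => 3 * x ^ 2 - 2 * x ^ 3
  let f : ℕ → R := fun n => next^[n] a
  have hf (n : ℕ) : f (n + 1) = 3 * f n ^ 2 - 2 * f n ^ 3 :=
    Function.iterate_succ_apply' next n a
  have hle {m n : ℕ} (h : m ≤ n) : (I ^ n • ⊤ : Submodule A R) ≤ I ^ m • ⊤ :=
    Submodule.smul_mono_left (Ideal.pow_le_pow_right h)
  have hidem (n : ℕ) : f n * f n - f n ∈ (I ^ (n + 1) • ⊤ : Submodule A R) := by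
    induction n with
    | zero => simpa [f] using ha
    | succ n ih =>
      have key : f (n + 1) * f (n + 1) - f (n + 1) =
          (f n * f n - f n) * (f n * f n - f n) * (4 * f n ^ 2 - 4 * f n - 3) := by
        rw [hf]; noncomm_ring
      rw [key]
      refine Ideal.mul_mem_smul_top_right _ (hle (?_ : n + 1 + 1 ≤ (n + 1) + (n + 1)) ?_)
      · lia
      · rw [pow_add]
        exact Ideal.mul_mem_mul_smul_top ih ih
  have hstep (n : ℕ) : f (n + 1) - f n ∈ (I ^ (n + 1) • ⊤ : Submodule A R) := by
    have key : f (n + 1) - f n = (f n * f n - f n) * (1 - 2 * f n) := by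
      rw [hf]; noncomm_ring
    rw [key]
    exact Ideal.mul_mem_smul_top_right _ (hidem n)
  obtain ⟨e, he⟩ := IsPrecomplete.prec' (I := I) f fun {m n} hmn => by
    induction n, hmn using Nat.le_induction with
    | base => rfl
    | succ n hmn ih =>
      refine ih.trans (SModEq.symm ?_)
      rw [SModEq.sub_mem]
      exact hle (by lia) (hstep n)
  simp only [SModEq.sub_mem] at he
  refine ⟨e, ?_, ?_⟩
  · rw [IsIdempotentElem, ← sub_eq_zero]
    refine IsHausdorff.haus' (I := I) _ fun n => ?_
    rw [SModEq.zero]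
    have key : e * e - e =
        (f n * f n - f n) - (f n - e) * e - f n * (f n - e) + (f n - e) := by noncomm_ring
    rw [key]
    exact add_mem (sub_mem (sub_mem (hle n.le_succ (hidem n))
      (Ideal.mul_mem_smul_top_right _ (he n))) (Ideal.mul_mem_smul_top_left _ (he n))) (he n)
  · have h₁ := he 1
    have h₀ := hstep 0
    simp only [zero_add, pow_one] at h₀ h₁
    have key : e - a = (f 1 - f 0) - (f 1 - e) := by simp [f]
    rw [key]
    exact sub_mem h₀ h₁

end AdicallyComplete

lemma azumayaMap_tmul {A R : Type*} [CommRing A] [Ring R] [Algebra A R] (r : R) (s : Rᵐᵒᵖ)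
    (x : R) : azumayaMap A R (r ⊗ₜ s) x = r * x * s.unop := by
  simp [azumayaMap]

section ResidueAlgebra

variable {A R : Type*} [CommRing A] [IsLocalRing A] [Ring R] [Algebra A R]

lemma one_tmul_residueField_eq_zero_iff (x : R) :
    (1 : ResidueField A) ⊗ₜ[A] x = 0 ↔ x ∈ (maximalIdeal A • ⊤ : Submodule A R) := by
  have h := (TensorProduct.quotTensorEquivQuotSMul R (maximalIdeal A)).map_eq_zero_iff
    (x := (1 : A ⧸ maximalIdeal A) ⊗ₜ[A] x)
  refine h.symm.trans ?_
  rw [← map_one (Ideal.Quotient.mk _), TensorProduct.quotTensorEquivQuotSMul_mk_tmul, one_smul,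
    Submodule.Quotient.mk_eq_zero]

lemma exists_one_tmul_eq (z : ResidueField A ⊗[A] R) :
    ∃ x : R, (1 : ResidueField A) ⊗ₜ[A] x = z :=
  TensorProduct.mk_surjective A R _ residue_surjective z

lemma isSimpleRing_residueField_tensor [Module.Free A R] [Module.Finite A R] [Nontrivial R]
    (h : Function.Surjective (azumayaMap A R)) : IsSimpleRing (ResidueField A ⊗[A] R) := by
  let b := Module.Free.chooseBasis A R
  have : Nontrivial (ResidueField A ⊗[A] R) :=
    (Algebra.TensorProduct.basis (ResidueField A) b).repr.toEquiv.nontrivial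
  refine IsSimpleRing.of_eq_bot_or_eq_top fun J => or_iff_not_imp_left.2 fun hJ => ?_
  obtain ⟨z, hzJ, hz⟩ : ∃ z ∈ J, z ≠ 0 := by
    by_contra! hc
    exact hJ (bot_unique fun z hz => (TwoSidedIdeal.mem_bot _).2 (hc z hz))
  obtain ⟨x, rfl⟩ := exists_one_tmul_eq z
  have hx := mt (one_tmul_residueField_eq_zero_iff x).2 hz
  rw [b.mem_smul_top_iff] at hx
  push Not at hx
  obtain ⟨i, hi⟩ := hx
  obtain ⟨u, hu⟩ : IsUnit (b.repr x i) := by simpa using hi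
  obtain ⟨t, ht⟩ := h ((b.coord i).smulRight (((u⁻¹ : Aˣ) : A) • (1 : R)))
  have hmem (t : R ⊗[A] Rᵐᵒᵖ) : (1 : ResidueField A) ⊗ₜ[A] azumayaMap A R t x ∈ J := by
    induction t with
    | zero => simp
    | tmul r s =>
      rw [azumayaMap_tmul]
      have := J.mul_mem_right _ (1 ⊗ₜ s.unop) (J.mul_mem_left (1 ⊗ₜ r) _ hzJ)
      simpa using this
    | add t t' h h' => simpa [TensorProduct.tmul_add] using J.add_mem h h'
  have h1 := hmem t
  rw [ht] at h1
  have : (1 : ResidueField A ⊗[A] R) ∈ J := by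
    simpa [← hu, smul_smul, Algebra.TensorProduct.one_def] using h1
  exact (TwoSidedIdeal.one_mem_iff _).1 this

end ResidueAlgebra

section Corner

variable {A R : Type*} [CommRing A] [Ring R] [Algebra A R]

/-- The action of `R` on the left ideal `R e` by left multiplication. -/
def leftMulRangeMulRight (e : R) :
    R →ₐ[A] Module.End A (LinearMap.range (LinearMap.mulRight A e)) :=
  AlgHom.ofLinearMap
    { toFun := fun r => (LinearMap.mulLeft A r).restrict (by
        rintro _ ⟨x, rfl⟩
        exact ⟨r * x, by simp [mul_assoc]⟩)
      map_add' := fun r s => by ext; simp [add_mul]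
      map_smul' := fun a r => by ext; simp }
    (by ext; simp)
    (fun r s => by ext; simp)

@[simp]
lemma coe_leftMulRangeMulRight_apply (e r : R) (x : LinearMap.range (LinearMap.mulRight A e)) :
    (leftMulRangeMulRight (A := A) e r x : R) = r * x := rfl

lemma mul_eq_of_mem_range_mulRight {e : R} (he : IsIdempotentElem e) {x : R}
    (hx : x ∈ LinearMap.range (LinearMap.mulRight A e)) : x * e = x := by
  obtain ⟨y, rfl⟩ := hx
  simp [mul_assoc, he.eq]

lemma leftMulRangeMulRight_injective {ι : Type*} (b : Basis ι A R)
    (h : Function.Surjective (azumayaMap A R)) {e : R}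
    (hann : ∀ a : A, a • e = 0 → a = 0) :
    Function.Injective (leftMulRangeMulRight (A := A) e) := by
  rw [injective_iff_map_eq_zero]
  intro x hx
  have hx0 (y : R) : x * (y * e) = 0 := by
    have := congrArg Subtype.val (LinearMap.congr_fun hx ⟨y * e, y, rfl⟩)
    simpa using this
  have hmem (t : R ⊗[A] Rᵐᵒᵖ) : azumayaMap A R t x * e = 0 := by
    induction t with
    | zero => simp
    | tmul r s => rw [azumayaMap_tmul, mul_assoc, mul_assoc, hx0, mul_zero]
    | add t t' h h' => simp [add_mul, h, h']
  refine b.ext_elem fun i => ?_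
  obtain ⟨t, ht⟩ := h ((b.coord i).smulRight (1 : R))
  have := hmem t
  rw [ht] at this
  simpa using hann _ (by simpa using this)

lemma leftMulRangeMulRight_surjective (h : Function.Surjective (azumayaMap A R)) {e : R}
    (he : IsIdempotentElem e) (hcorner : ∀ s : R, ∃ c : A, e * s * e = c • e) :
    Function.Surjective (leftMulRangeMulRight (A := A) e) := by
  intro φ
  have hmem (t : R ⊗[A] Rᵐᵒᵖ) : ∃ r : R, ∀ x : R, x * e = x → azumayaMap A R t x * e = r * x := by
    induction t with
    | zero => exact ⟨0, by simp⟩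
    | tmul r s =>
      obtain ⟨c, hc⟩ := hcorner s.unop
      refine ⟨c • r, fun x hx => ?_⟩
      calc azumayaMap A R (r ⊗ₜ s) x * e = r * (x * e) * s.unop * e := by
            rw [azumayaMap_tmul, hx]
        _ = r * x * (e * s.unop * e) := by noncomm_ring
        _ = c • r * x := by rw [hc, mul_smul_comm, mul_assoc, hx, smul_mul_assoc]
    | add t t' h h' =>
      obtain ⟨r, hr⟩ := h
      obtain ⟨r', hr'⟩ := h'
      exact ⟨r + r', fun x hx => by simp [add_mul, hr x hx, hr' x hx]⟩
  obtain ⟨t, ht⟩ := h ((LinearMap.range (LinearMap.mulRight A e)).subtype ∘ₗ φ ∘ₗ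
    (LinearMap.mulRight A e).rangeRestrict)
  obtain ⟨r, hr⟩ := hmem t
  refine ⟨r, ?_⟩
  ext x
  have hx := mul_eq_of_mem_range_mulRight he x.2
  have hx' : (LinearMap.mulRight A e).rangeRestrict x = x := Subtype.ext hx
  rw [coe_leftMulRangeMulRight_apply, ← hr x hx, ht]
  simp only [LinearMap.comp_apply, hx', Submodule.subtype_apply]
  exact mul_eq_of_mem_range_mulRight he (φ x).2

end Corner

/-- A local Azumaya algebra splits if its reduction has an idempotent with scalar corner. -/
lemma exists_algEquiv_matrix_of_corner_mod_maximalIdeal {A R : Type*} [CommRing A] [IsLocalRing A]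
    [Ring R] [Algebra A R] [Module.Free A R] [Module.Finite A R]
    (h : Function.Surjective (azumayaMap A R)) {e : R} (he : IsIdempotentElem e)
    (he0 : e ∉ (maximalIdeal A • ⊤ : Submodule A R))
    (hcorner : ∀ s : R, ∃ c : A, e * s * e - c • e ∈ (maximalIdeal A • ⊤ : Submodule A R)) :
    ∃ n : ℕ, Nonempty (R ≃ₐ[A] Matrix (Fin n) (Fin n) A) := by
  let b := Module.Free.chooseBasis A R
  have hann (a : A) (ha : a • e = 0) : a = 0 := by
    rw [b.mem_smul_top_iff] at he0
    push Not at he0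
    obtain ⟨i, hi⟩ := he0
    have hu : IsUnit (b.repr e i) := by simpa using hi
    have := congrArg (fun x => b.repr x i) ha
    simpa [hu.mul_left_eq_zero] using this
  let κ : R →ₗ[A] R := LinearMap.mulRight A e ∘ₗ LinearMap.mulLeft A e
  have hκ (s : R) : κ s = e * s * e := rfl
  have hle : LinearMap.range κ ≤ Submodule.span A {e} := by
    refine Submodule.le_of_le_smul_of_le_jacobson_bot (I := maximalIdeal A)
      (Module.Finite.iff_fg.1 inferInstance) (maximalIdeal_le_jacobson _) ?_
    rintro _ ⟨s, rfl⟩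
    obtain ⟨c, hc⟩ := hcorner s
    have hmem : κ (e * s * e - c • e) ∈ maximalIdeal A • LinearMap.range κ := by
      have := Submodule.mem_map_of_mem (f := κ) hc
      rwa [Submodule.map_smul'', Submodule.map_top] at this
    have hs : κ s = c • e + κ (e * s * e - c • e) := by
      have h₁ : e * (e * s * e) * e = e * s * e := by
        rw [show e * (e * s * e) * e = (e * e) * s * (e * e) by noncomm_ring, he.eq]
      simp only [hκ, mul_sub, sub_mul, h₁, mul_smul_comm, smul_mul_assoc, he.eq]
      abel
    rw [hs]
    exact Submodule.add_mem_sup (Submodule.smul_mem _ _ (Submodule.mem_span_singleton_self e)) hmem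
  have hcorner' (s : R) : ∃ c : A, e * s * e = c • e := by
    obtain ⟨c, hc⟩ := Submodule.mem_span_singleton.1 (hle ⟨s, rfl⟩)
    exact ⟨c, hc.symm⟩
  have hproj : Module.Projective A (LinearMap.range (LinearMap.mulRight A e)) :=
    Module.Projective.of_split (Submodule.subtype _) (LinearMap.mulRight A e).rangeRestrict
      (LinearMap.ext fun x => Subtype.ext (mul_eq_of_mem_range_mulRight he x.2))
  have hfree : Module.Free A (LinearMap.range (LinearMap.mulRight A e)) :=
    Module.free_of_flat_of_isLocalRing
  exact ⟨_, ⟨(AlgEquiv.ofBijective (leftMulRangeMulRight (A := A) e)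
    ⟨leftMulRangeMulRight_injective b h hann, leftMulRangeMulRight_surjective h he hcorner'⟩).trans
    (algEquivMatrix (Module.finBasis A _))⟩⟩

/-- Every Azumaya algebra over a complete local commutative noetherian ring with
algebraically closed residue field is a matrix algebra. -/
theorem azumaya_over_complete_local_is_matrix (A : Type*) [CommRing A] [IsNoetherianRing A]
    [IsLocalRing A] [IsAdicComplete (IsLocalRing.maximalIdeal A) A]
    [IsAlgClosed (IsLocalRing.ResidueField A)]
    (R : Type*) [Ring R] [Algebra A R]
    (hfin : Module.Finite A R) (hproj : Module.Projective A R)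
    (hfaith : FaithfulSMul A R)
    (hAzumaya : Function.Bijective (azumayaMap A R)) :
    ∃ n : ℕ, Nonempty (R ≃ₐ[A] Matrix (Fin n) (Fin n) A) := by
  have hfree : Module.Free A R := Module.free_of_flat_of_isLocalRing
  have : Nontrivial R := (FaithfulSMul.algebraMap_injective A R).nontrivial
  have : IsPrecomplete (maximalIdeal A) R :=
    .of_basis (Module.Free.chooseBasis A R) (maximalIdeal A)
  have : IsAdicComplete (maximalIdeal A) R := { }
  have := isSimpleRing_residueField_tensor hAzumaya.surjective
  obtain ⟨n, hn, ⟨g⟩⟩ := IsSimpleRing.exists_algEquiv_matrix_of_isAlgClosed (ResidueField A)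
    (ResidueField A ⊗[A] R)
  let π : R →ₐ[A] ResidueField A ⊗[A] R := Algebra.TensorProduct.includeRight
  have hπ (x : R) : π x = 0 ↔ x ∈ (maximalIdeal A • ⊤ : Submodule A R) :=
    one_tmul_residueField_eq_zero_iff x
  let E : Matrix (Fin n) (Fin n) (ResidueField A) := Matrix.single 0 0 1
  obtain ⟨a, ha⟩ : ∃ a, π a = g.symm E := exists_one_tmul_eq _
  obtain ⟨e, he, hea⟩ := exists_isIdempotentElem_sub_mem_smul_top (maximalIdeal A) a (by
    rw [← hπ, map_sub, map_mul, ha, ← map_mul, sub_eq_zero]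
    simp [E])
  have hge : g (π e) = E := by
    rw [← hπ, map_sub, sub_eq_zero] at hea
    rw [hea, ha, AlgEquiv.apply_symm_apply]
  refine exists_algEquiv_matrix_of_corner_mod_maximalIdeal hAzumaya.surjective he ?_ fun s => ?_
  · rw [← hπ, ← map_eq_zero_iff g g.injective, hge]
    intro h0
    simpa [E] using congrFun₂ h0 0 0
  · obtain ⟨c, hc⟩ := residue_surjective (g (π s) 0 0)
    refine ⟨c, ?_⟩
    have hsmul : g (c • π e) = residue A c • E := by
      rw [← algebraMap_smul (ResidueField A) c, map_smul g, hge, ResidueField.algebraMap_eq]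
    rw [← hπ, ← map_eq_zero_iff g g.injective, map_sub, map_mul, map_mul, map_smul, map_sub,
      hsmul, map_mul, map_mul, hge, hc, sub_eq_zero]
    ext i j
    simp [E, Matrix.single_apply]
end
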